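/- arXiv:math/0501024 — 3 statements merged into one kernel-verified Lean document; each statement's English description precedes it below -/
import Mathlib

section
/- Let A, B : ℝ² → ℝ be smooth functions. Define the matrix-valued map G : ℝ⁴ → (4×4 real symmetric matrices) in coordinates (x,y,z,t) by G_xx = −(t² + 2B(x,y)), G_xt = G_tx = 1, G_yy = 2A(x,y) − z², G_yz = G_zy = 1, and all other entries zero. Then G(x,y,z,t) is invertible at every point, and the coordinate Ricci tensor of G satisfies Ric_{ij} = −G_{ij} at every point of ℝ⁴; that is, the split signature metric G = −[t²+2B(x,y)]dx² + 2 dt dx + [2A(x,y)−z²]dy² + 2 dz dy is Einstein with cosmological constant Λ = −1. -/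
open Matrix

/-- Partial derivative in the `i`-th coordinate direction of a function on `ℝ⁴`. -/
noncomputable def pd (i : Fin 4) (f : (Fin 4 → ℝ) → ℝ) (x : Fin 4 → ℝ) : ℝ :=
  fderiv ℝ f x (Pi.single i 1)

/-- Christoffel symbols `Γ^k_{ij}` of a matrix-valued map `g` on `ℝ⁴`. -/
noncomputable def christoffel (g : (Fin 4 → ℝ) → Matrix (Fin 4) (Fin 4) ℝ)
    (k i j : Fin 4) (x : Fin 4 → ℝ) : ℝ :=
  (1 / 2) * ∑ l, (g x)⁻¹ k l *
    (pd i (fun y => g y l j) x + pd j (fun y => g y l i) x - pd l (fun y => g y i j) x)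

/-- Coordinate Ricci tensor `Ric_{ij}` of a matrix-valued map `g` on `ℝ⁴`. -/
noncomputable def ricci (g : (Fin 4 → ℝ) → Matrix (Fin 4) (Fin 4) ℝ)
    (i j : Fin 4) (x : Fin 4 → ℝ) : ℝ :=
  (∑ k, pd k (christoffel g k i j) x) - (∑ k, pd j (christoffel g k i k) x)
    + ∑ k, ∑ l, (christoffel g k k l x * christoffel g l i j x
        - christoffel g k j l x * christoffel g l i k x)

lemma pd_const (i : Fin 4) (c : ℝ) (x : Fin 4 → ℝ) : pd i (fun _ => c) x = 0 := by
  simp [pd]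

lemma pd_coord (i j : Fin 4) (x : Fin 4 → ℝ) :
    pd i (fun p => p j) x = (Pi.single i 1 : Fin 4 → ℝ) j := by
  unfold pd
  have h : HasFDerivAt (fun p : Fin 4 → ℝ => p j)
    (ContinuousLinearMap.proj (R := ℝ) (φ := fun _ : Fin 4 => ℝ) j) x := hasFDerivAt_apply j x
  rw [h.fderiv]; rfl

lemma pd_neg (i : Fin 4) (f : (Fin 4 → ℝ) → ℝ) (x : Fin 4 → ℝ) :
    pd i (fun p => -f p) x = -pd i f x := by
  simp [pd, fderiv_fun_neg]

lemma pd_add (i : Fin 4) (f g : (Fin 4 → ℝ) → ℝ) (x : Fin 4 → ℝ)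
    (hf : DifferentiableAt ℝ f x) (hg : DifferentiableAt ℝ g x) :
    pd i (fun p => f p + g p) x = pd i f x + pd i g x := by
  simp [pd, fderiv_fun_add hf hg]

lemma pd_sub (i : Fin 4) (f g : (Fin 4 → ℝ) → ℝ) (x : Fin 4 → ℝ)
    (hf : DifferentiableAt ℝ f x) (hg : DifferentiableAt ℝ g x) :
    pd i (fun p => f p - g p) x = pd i f x - pd i g x := by
  simp [pd, fderiv_fun_sub hf hg]

lemma pd_mul (i : Fin 4) (f g : (Fin 4 → ℝ) → ℝ) (x : Fin 4 → ℝ)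
    (hf : DifferentiableAt ℝ f x) (hg : DifferentiableAt ℝ g x) :
    pd i (fun p => f p * g p) x = f x * pd i g x + g x * pd i f x := by
  simp [pd, fderiv_fun_mul hf hg]

lemma pd_comp (i : Fin 4) (F : ℝ × ℝ → ℝ) (hF : Differentiable ℝ F) (x : Fin 4 → ℝ) :
    pd i (fun p => F (p 0, p 1)) x =
      fderiv ℝ F (x 0, x 1) ((Pi.single i 1 : Fin 4 → ℝ) 0, (Pi.single i 1 : Fin 4 → ℝ) 1) := by
  unfold pd
  have h0 : HasFDerivAt (fun p : Fin 4 → ℝ => p 0)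
    (ContinuousLinearMap.proj (R := ℝ) (φ := fun _ : Fin 4 => ℝ) 0) x := hasFDerivAt_apply 0 x
  have h1 : HasFDerivAt (fun p : Fin 4 → ℝ => p 1)
    (ContinuousLinearMap.proj (R := ℝ) (φ := fun _ : Fin 4 => ℝ) 1) x := hasFDerivAt_apply 1 x
  have h := (hF (x 0, x 1)).hasFDerivAt.comp x (h0.prodMk h1)
  have h' : fderiv ℝ (fun p : Fin 4 → ℝ => F (p 0, p 1)) x = _ := h.fderiv
  rw [h']; rfl

/-- metric entries -/
noncomputable def gE (A B : ℝ × ℝ → ℝ) (p : Fin 4 → ℝ) : Matrix (Fin 4) (Fin 4) ℝ :=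
  !![-(p 3 * p 3 + 2 * B (p 0, p 1)), 0, 0, 1;
               0, 2 * A (p 0, p 1) - p 2 * p 2, 1, 0;
               0, 1, 0, 0;
               1, 0, 0, 0]

/-- explicit Christoffel symbols, upper index first -/
noncomputable def chE (A Ax Ay B Bx By : ℝ × ℝ → ℝ) (k i j : Fin 4) : (Fin 4 → ℝ) → ℝ := fun p =>
  (![!![p 3, 0, 0, 0; 0, 0, 0, 0; 0, 0, 0, 0; 0, 0, 0, 0],
    !![0, 0, 0, 0; 0, p 2, 0, 0; 0, 0, 0, 0; 0, 0, 0, 0],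
    !![By (p 0, p 1), Ax (p 0, p 1), 0, 0;
       Ax (p 0, p 1), Ay (p 0, p 1) - (2 * A (p 0, p 1) - p 2 * p 2) * p 2, -p 2, 0;
       0, -p 2, 0, 0; 0, 0, 0, 0],
    !![-Bx (p 0, p 1) + (p 3 * p 3 + 2 * B (p 0, p 1)) * p 3, -By (p 0, p 1), 0, -p 3;
       -By (p 0, p 1), -Ax (p 0, p 1), 0, 0; 0, 0, 0, 0; -p 3, 0, 0, 0]] :
    Fin 4 → Matrix (Fin 4) (Fin 4) ℝ) k i j

lemma gE_inv_aux (A B : ℝ × ℝ → ℝ) (p : Fin 4 → ℝ) :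
    gE A B p * !![0, 0, 0, 1; 0, 0, 1, 0; 0, 1, -(2 * A (p 0, p 1) - p 2 * p 2), 0;
      1, 0, 0, p 3 * p 3 + 2 * B (p 0, p 1)] = 1 := by
  ext i j
  fin_cases i <;> fin_cases j <;> simp [gE, Matrix.mul_apply, Fin.sum_univ_four]

lemma ch_eq (A B : ℝ × ℝ → ℝ) (hA : Differentiable ℝ A) (hB : Differentiable ℝ B)
    (k i j : Fin 4) :
    christoffel (gE A B) k i j = chE A (fun q => fderiv ℝ A q (1, 0)) (fun q => fderiv ℝ A q (0, 1))
      B (fun q => fderiv ℝ B q (1, 0)) (fun q => fderiv ℝ B q (0, 1)) k i j := by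
  funext p
  have h0 : ((0 : ℝ), (0 : ℝ)) = 0 := rfl
  have hu : ∀ i, pd i (fun p => -(p 3 * p 3 + 2 * B (p 0, p 1))) p =
      ![-2 * fderiv ℝ B (p 0, p 1) (1, 0), -2 * fderiv ℝ B (p 0, p 1) (0, 1), 0, -2 * p 3] i := by
    intro i
    rw [pd_neg, pd_add _ _ _ _ (by fun_prop) (by fun_prop), pd_mul _ _ _ _ (by fun_prop) (by fun_prop),
      pd_mul _ _ _ _ (by fun_prop) (by fun_prop), pd_const, pd_comp _ _ hB, pd_coord]
    fin_cases i <;> simp [h0] <;> ring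
  have hv : ∀ i, pd i (fun p => 2 * A (p 0, p 1) - p 2 * p 2) p =
      ![2 * fderiv ℝ A (p 0, p 1) (1, 0), 2 * fderiv ℝ A (p 0, p 1) (0, 1), -2 * p 2, 0] i := by
    intro i
    rw [pd_sub _ _ _ _ (by fun_prop) (by fun_prop), pd_mul _ _ _ _ (by fun_prop) (by fun_prop),
      pd_mul _ _ _ _ (by fun_prop) (by fun_prop), pd_const, pd_comp _ _ hA, pd_coord]
    fin_cases i <;> simp [h0] <;> ring
  have hd : ∀ m i j, pd m (fun y => gE A B y i j) p =
      (!![pd m (fun p => -(p 3 * p 3 + 2 * B (p 0, p 1))) p, 0, 0, 0;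
        0, pd m (fun p => 2 * A (p 0, p 1) - p 2 * p 2) p, 0, 0; 0, 0, 0, 0; 0, 0, 0, 0] :
        Matrix (Fin 4) (Fin 4) ℝ) i j := by
    intro m i j
    fin_cases i <;> fin_cases j <;> first | rfl | exact pd_const _ _ _
  unfold christoffel
  rw [Matrix.inv_eq_right_inv (gE_inv_aux A B p)]
  simp only [hd, hu, hv, Fin.sum_univ_four]
  fin_cases k <;> fin_cases i <;> fin_cases j <;> simp [chE] <;> ring

lemma ricci_eq (A Ax Ay B Bx By : ℝ × ℝ → ℝ) (hA : Differentiable ℝ A) (hB : Differentiable ℝ B)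
    (hAx : Differentiable ℝ Ax) (hAy : Differentiable ℝ Ay)
    (hBx : Differentiable ℝ Bx) (hBy : Differentiable ℝ By)
    (hc : ∀ k i j, christoffel (gE A B) k i j = chE A Ax Ay B Bx By k i j)
    (p : Fin 4 → ℝ) (i j : Fin 4) : ricci (gE A B) i j p = -(gE A B p i j) := by
  have hcomp : ∀ F : ℝ × ℝ → ℝ, Differentiable ℝ F → pd 2 (fun p => F (p 0, p 1)) p = 0
      ∧ pd 3 (fun p => F (p 0, p 1)) p = 0 := by
    intro F hF
    have h0 : ((0 : ℝ), (0 : ℝ)) = 0 := rfl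
    constructor <;> rw [pd_comp _ _ hF] <;> simp [Pi.single_apply, h0]
  have h1 : pd 3 (fun p => -Bx (p 0, p 1) + (p 3 * p 3 + 2 * B (p 0, p 1)) * p 3) p
      = 3 * p 3 * p 3 + 2 * B (p 0, p 1) := by
    rw [pd_add _ _ _ _ (by fun_prop) (by fun_prop), pd_neg, pd_mul _ _ _ _ (by fun_prop) (by fun_prop),
      pd_add _ _ _ _ (by fun_prop) (by fun_prop), pd_mul _ _ _ _ (by fun_prop) (by fun_prop),
      pd_mul _ _ _ _ (by fun_prop) (by fun_prop), pd_const, pd_coord, (hcomp Bx hBx).2,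
      (hcomp B hB).2]
    simp; ring
  have h2 : pd 2 (fun p => Ay (p 0, p 1) - (2 * A (p 0, p 1) - p 2 * p 2) * p 2) p
      = 3 * p 2 * p 2 - 2 * A (p 0, p 1) := by
    rw [pd_sub _ _ _ _ (by fun_prop) (by fun_prop), pd_mul _ _ _ _ (by fun_prop) (by fun_prop),
      pd_sub _ _ _ _ (by fun_prop) (by fun_prop), pd_mul _ _ _ _ (by fun_prop) (by fun_prop),
      pd_mul _ _ _ _ (by fun_prop) (by fun_prop), pd_const, pd_coord, (hcomp Ay hAy).1,
      (hcomp A hA).1]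
    simp; ring
  have e1 := (hcomp Ax hAx).1
  have e2 := (hcomp Ax hAx).2
  have e3 := (hcomp By hBy).1
  have e4 := (hcomp By hBy).2
  unfold ricci
  simp only [hc, Fin.sum_univ_four]
  unfold chE
  fin_cases i <;> fin_cases j <;>
    simp [gE, pd_const, pd_coord, pd_neg, h1, h2, e1, e2, e3, e4, Pi.single_apply] <;> ring

/-- The split signature metric
`G = −[t²+2B(x,y)]dx² + 2 dt dx + [2A(x,y)−z²]dy² + 2 dz dy`,
with coordinates `(x,y,z,t) = (p 0, p 1, p 2, p 3)`, is Einstein: `Ric = −G`. -/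
theorem split_signature_metric_is_einstein
    (A B : ℝ × ℝ → ℝ) (hA : ContDiff ℝ (⊤ : ℕ∞) A) (hB : ContDiff ℝ (⊤ : ℕ∞) B)
    (G : (Fin 4 → ℝ) → Matrix (Fin 4) (Fin 4) ℝ)
    (hG : ∀ p : Fin 4 → ℝ,
      G p = !![-(p 3 ^ 2 + 2 * B (p 0, p 1)), 0, 0, 1;
               0, 2 * A (p 0, p 1) - p 2 ^ 2, 1, 0;
               0, 1, 0, 0;
               1, 0, 0, 0]) :
    ∀ p : Fin 4 → ℝ, IsUnit (G p) ∧ ∀ i j : Fin 4, ricci G i j p = -(G p i j) := by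
  have hGe : G = gE A B := by
    funext p
    rw [hG, gE, pow_two, pow_two]
  subst hGe
  intro p
  refine ⟨IsUnit.of_mul_eq_one _ (gE_inv_aux A B p), fun i j => ?_⟩
  have hA1 : Differentiable ℝ A := hA.differentiable (by simp)
  have hB1 : Differentiable ℝ B := hB.differentiable (by simp)
  have key : ∀ F : ℝ × ℝ → ℝ, ContDiff ℝ (⊤ : ℕ∞) F → ∀ v,
      Differentiable ℝ (fun q => fderiv ℝ F q v) := by
    intro F hF v
    have h : ContDiff ℝ 1 (fderiv ℝ F) := hF.fderiv_right (by norm_cast)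
    have h' : Differentiable ℝ (fderiv ℝ F) := h.differentiable (by simp)
    fun_prop
  exact ricci_eq A _ _ B _ _ hA1 hB1 (key A hA _) (key A hA _) (key B hB _) (key B hB _)
    (ch_eq A B hA1 hB1) p i j
end

section
/- Let B : ℝ → ℝ be smooth. Define the matrix-valued map g : ℝ² → (2×2 real symmetric matrices) in coordinates (x,t) by g_xx = −(t² + 2B(x)), g_xt = g_tx = 1, g_tt = 0 (encoding the two-dimensional metric 2 dt dx − [t²+2B(x)]dx²). Then g is invertible at every point and its coordinate Ricci tensor satisfies Ric_{ij} = −g_{ij} at every point of ℝ². -/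
open Matrix

/-- Partial derivative in the `i`-th coordinate direction of a function on `ℝ²`. -/
noncomputable def pd2 (i : Fin 2) (f : (Fin 2 → ℝ) → ℝ) (x : Fin 2 → ℝ) : ℝ :=
  fderiv ℝ f x (Pi.single i 1)

/-- Christoffel symbols `Γ^k_{ij}` of a matrix-valued map `g` on `ℝ²`. -/
noncomputable def christoffel2 (g : (Fin 2 → ℝ) → Matrix (Fin 2) (Fin 2) ℝ)
    (k i j : Fin 2) (x : Fin 2 → ℝ) : ℝ :=
  (1 / 2) * ∑ l, (g x)⁻¹ k l *
    (pd2 i (fun y => g y l j) x + pd2 j (fun y => g y l i) x - pd2 l (fun y => g y i j) x)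

/-- Coordinate Ricci tensor `Ric_{ij}` of a matrix-valued map `g` on `ℝ²`. -/
noncomputable def ricci2 (g : (Fin 2 → ℝ) → Matrix (Fin 2) (Fin 2) ℝ)
    (i j : Fin 2) (x : Fin 2 → ℝ) : ℝ :=
  (∑ k, pd2 k (christoffel2 g k i j) x) - (∑ k, pd2 j (christoffel2 g k i k) x)
    + ∑ k, ∑ l, (christoffel2 g k k l x * christoffel2 g l i j x
        - christoffel2 g k j l x * christoffel2 g l i k x)

theorem pd2_aux (a b : ℝ → ℝ) (c d : ℝ) (ha : Differentiable ℝ a) (hb : Differentiable ℝ b)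
    (f : (Fin 2 → ℝ) → ℝ)
    (hf : ∀ p, f p = a (p 0) + b (p 0) * p 1 + c * p 1 ^ 2 + d * p 1 ^ 3) (p : Fin 2 → ℝ) :
    pd2 0 f p = deriv a (p 0) + deriv b (p 0) * p 1 ∧
    pd2 1 f p = b (p 0) + 2 * c * p 1 + 3 * d * p 1 ^ 2 := by
  have h0 : HasFDerivAt (fun q : Fin 2 → ℝ => q 0)
      (ContinuousLinearMap.proj (R := ℝ) (φ := fun _ : Fin 2 => ℝ) 0) p := hasFDerivAt_apply 0 p
  have h1 : HasFDerivAt (fun q : Fin 2 → ℝ => q 1)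
      (ContinuousLinearMap.proj (R := ℝ) (φ := fun _ : Fin 2 => ℝ) 1) p := hasFDerivAt_apply 1 p
  have hA := (ha (p 0)).hasDerivAt.comp_hasFDerivAt p h0
  have hB := (hb (p 0)).hasDerivAt.comp_hasFDerivAt p h0
  have H := ((hA.add (hB.mul h1)).add ((h1.pow 2).const_mul c)).add ((h1.pow 3).const_mul d)
  have H' : HasFDerivAt f _ p := H.congr_of_eventuallyEq
    (Filter.Eventually.of_forall fun q => by simp [hf q])
  unfold pd2
  rw [H'.fderiv]
  constructor
  · simp
    try ring
  · simp
    try ring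

/-- The two-dimensional metric `g = 2 dt dx − [t²+2B(x)]dx²`, with coordinates
`(x,t) = (p 0, p 1)`, is invertible at every point and Einstein: `Ric = −g`. -/
theorem two_dim_block_metric_is_einstein
    (B : ℝ → ℝ) (hB : ContDiff ℝ (⊤ : ℕ∞) B)
    (g : (Fin 2 → ℝ) → Matrix (Fin 2) (Fin 2) ℝ)
    (hg : ∀ p : Fin 2 → ℝ,
      g p = !![-(p 1 ^ 2 + 2 * B (p 0)), 1;
               1, 0]) :
    ∀ p : Fin 2 → ℝ, IsUnit (g p) ∧ ∀ i j : Fin 2, ricci2 g i j p = -(g p i j) := by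
  have hB1 : Differentiable ℝ B := hB.differentiable (by simp)
  have hB2 : Differentiable ℝ (deriv B) :=
    ((contDiff_infty_iff_deriv.mp hB).2).differentiable (by simp)
  have hinv : ∀ p, (g p)⁻¹ = !![0, 1; 1, p 1 ^ 2 + 2 * B (p 0)] := by
    intro p
    apply Matrix.inv_eq_right_inv
    rw [hg]
    ext i j
    fin_cases i <;> fin_cases j <;> simp [Matrix.mul_apply, Fin.sum_univ_two]
  have c0 : ∀ (c : ℝ) (i : Fin 2) (p : Fin 2 → ℝ), pd2 i (fun _ => c) p = 0 := by
    intro c i p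
    simp [pd2]
  have g01 : (fun y => g y 0 1) = fun _ => (1 : ℝ) := by funext y; simp [hg]
  have g10 : (fun y => g y 1 0) = fun _ => (1 : ℝ) := by funext y; simp [hg]
  have g11 : (fun y => g y 1 1) = fun _ => (0 : ℝ) := by funext y; simp [hg]
  have g00 := pd2_aux (fun x => -2 * B x) (fun _ => 0) (-1) 0 (hB1.const_mul _)
    (differentiable_const _) (fun y => g y 0 0) (by intro y; simp [hg])
  have d00 : ∀ p, pd2 0 (fun y => g y 0 0) p = -2 * deriv B (p 0) := by
    intro p
    rw [(g00 p).1, deriv_const_mul _ (hB1 _)]; simp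
  have d01 : ∀ p, pd2 1 (fun y => g y 0 0) p = -2 * p 1 := by
    intro p
    rw [(g00 p).2]; ring
  have G000 : christoffel2 g 0 0 0 = fun p => p 1 := by
    funext p
    simp [christoffel2, Fin.sum_univ_two, hinv, g01, g10, g11, c0, d00, d01]
  have G100 : christoffel2 g 1 0 0 =
      fun p => -deriv B (p 0) + 2 * B (p 0) * p 1 + p 1 ^ 3 := by
    funext p
    simp [christoffel2, Fin.sum_univ_two, hinv, g01, g10, g11, c0, d00, d01]
    ring
  have G001 : christoffel2 g 0 0 1 = fun _ => 0 := by
    funext p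
    simp [christoffel2, Fin.sum_univ_two, hinv, g01, g10, g11, c0, d00, d01]
  have G010 : christoffel2 g 0 1 0 = fun _ => 0 := by
    funext p
    simp [christoffel2, Fin.sum_univ_two, hinv, g01, g10, g11, c0, d00, d01]
  have G011 : christoffel2 g 0 1 1 = fun _ => 0 := by
    funext p
    simp [christoffel2, Fin.sum_univ_two, hinv, g01, g10, g11, c0, d00, d01]
  have G111 : christoffel2 g 1 1 1 = fun _ => 0 := by
    funext p
    simp [christoffel2, Fin.sum_univ_two, hinv, g01, g10, g11, c0, d00, d01]
  have G101 : christoffel2 g 1 0 1 = fun p => -p 1 := by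
    funext p
    simp [christoffel2, Fin.sum_univ_two, hinv, g01, g10, g11, c0, d00, d01]
  have G110 : christoffel2 g 1 1 0 = fun p => -p 1 := by
    funext p
    simp [christoffel2, Fin.sum_univ_two, hinv, g01, g10, g11, c0, d00, d01]
  have e1 := pd2_aux (fun _ => 0) (fun _ => 1) 0 0 (differentiable_const _)
    (differentiable_const _) (fun p => p 1) (by intro p; simp)
  have e2 := pd2_aux (fun _ => 0) (fun _ => -1) 0 0 (differentiable_const _)
    (differentiable_const _) (fun p => -p 1) (by intro p; simp)
  have e3 := pd2_aux (fun x => -deriv B x) (fun x => 2 * B x) 0 1 hB2.neg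
    (hB1.const_mul _) (fun p => -deriv B (p 0) + 2 * B (p 0) * p 1 + p 1 ^ 3)
    (by intro p; simp)
  intro p
  constructor
  · rw [Matrix.isUnit_iff_isUnit_det, hg, Matrix.det_fin_two_of]
    simp
  · intro i j
    fin_cases i <;> fin_cases j <;>
      simp [ricci2, Fin.sum_univ_two, G000, G001, G010, G011, G100, G101, G110, G111, c0,
        (e1 p).1, (e1 p).2, (e2 p).1, (e2 p).2, (e3 p).2, hg] <;> ring
end

section
/- Let g be the 4×4 real matrix with rows (0,1,0,0), (1,0,0,0), (0,0,0,1), (0,0,1,0). For real numbers τ¹, τ², τ³, τ⁴, Γ₁, Γ₂, let ω be the 4×4 real matrix with entries ω₁₁ = −(1/2)(Γ₁+Γ₂+τ⁴), ω₁₂ = 0, ω₁₃ = τ¹, ω₁₄ = −(1/2)τ⁴, ω₂₁ = 0, ω₂₂ = (1/2)(Γ₁+Γ₂+τ⁴), ω₂₃ = −Γ₂+τ³−(1/2)τ⁴, ω₂₄ = −(1/2)τ², ω₃₁ = (1/2)τ², ω₃₂ = (1/2)τ⁴, ω₃₃ = (1/2)(Γ₁−Γ₂−τ⁴), ω₃₄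 = 0, ω₄₁ = Γ₂−τ³+(1/2)τ⁴, ω₄₂ = −τ¹, ω₄₃ = 0, ω₄₄ = (1/2)(−Γ₁+Γ₂+τ⁴). Then the map (τ¹,τ²,τ³,τ⁴,Γ₁,Γ₂) ↦ ω is an injective linear map from ℝ⁶ to the 4×4 real matrices whose image is exactly the set {M : Mᵀ g + g M = 0}; in particular every such ω satisfies ωᵀ g + g ω = 0. -/
open Matrix

/-- The split signature (2,2) bilinear form on `ℝ⁴`. -/
def gSplit : Matrix (Fin 4) (Fin 4) ℝ :=
  !![0, 1, 0, 0;
     1, 0, 0, 0;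
     0, 0, 0, 1;
     0, 0, 1, 0]

/-- The `so(2,2)`-valued Cartan connection matrix `ω`, as a function of
`(τ¹, τ², τ³, τ⁴, Γ₁, Γ₂) = (v 0, v 1, v 2, v 3, v 4, v 5)`. -/
noncomputable def cartanConnectionMatrix (v : Fin 6 → ℝ) : Matrix (Fin 4) (Fin 4) ℝ :=
  !![-(1 / 2) * (v 4 + v 5 + v 3), 0, v 0, -(1 / 2) * v 3;
     0, (1 / 2) * (v 4 + v 5 + v 3), -(v 5) + v 2 - (1 / 2) * v 3, -(1 / 2) * v 1;
     (1 / 2) * v 1, (1 / 2) * v 3, (1 / 2) * (v 4 - v 5 - v 3), 0;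
     v 5 - v 2 + (1 / 2) * v 3, -(v 0), 0, (1 / 2) * (-(v 4) + v 5 + v 3)]

/-- The map `(τ¹,τ²,τ³,τ⁴,Γ₁,Γ₂) ↦ ω` is an injective linear map from `ℝ⁶` to the
4×4 real matrices whose image is exactly the Lie algebra `so(2,2)` of `g`-skew
matrices; in particular every such `ω` satisfies `ωᵀ g + g ω = 0`. -/
theorem cartan_connection_is_so22_valued :
    Function.Injective cartanConnectionMatrix ∧
    IsLinearMap ℝ cartanConnectionMatrix ∧
    Set.range cartanConnectionMatrix =
      {M : Matrix (Fin 4) (Fin 4) ℝ | Mᵀ * gSplit + gSplit * M = 0} := by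
  refine ⟨?_, ⟨?_, ?_⟩, ?_⟩
  · intro v w h
    have e : ∀ i j, cartanConnectionMatrix v i j = cartanConnectionMatrix w i j := by
      intro i j; rw [h]
    have h00 := e 0 0
    have h02 := e 0 2
    have h12 := e 1 2
    have h20 := e 2 0
    have h21 := e 2 1
    have h22 := e 2 2
    simp [cartanConnectionMatrix] at h00 h02 h12 h20 h21 h22
    ext i
    fin_cases i <;> simp <;> linarith
  · intro v w
    ext i j
    fin_cases i <;> fin_cases j <;> simp [cartanConnectionMatrix] <;> ring
  · intro c v
    ext i j
    fin_cases i <;> fin_cases j <;> simp [cartanConnectionMatrix] <;> ring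
  · ext M
    simp only [Set.mem_range, Set.mem_ofPred_eq]
    constructor
    · rintro ⟨v, rfl⟩
      ext i j
      fin_cases i <;> fin_cases j <;>
        simp [cartanConnectionMatrix, gSplit, Matrix.mul_apply, Fin.sum_univ_four] <;> ring
    · intro h
      have e : ∀ i j, (Mᵀ * gSplit + gSplit * M) i j = 0 := by
        intro i j; rw [h]; rfl
      have h00 := e 0 0
      have h01 := e 0 1
      have h02 := e 0 2
      have h03 := e 0 3
      have h11 := e 1 1
      have h12 := e 1 2
      have h13 := e 1 3
      have h22 := e 2 2
      have h23 := e 2 3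
      have h33 := e 3 3
      simp [gSplit, Matrix.mul_apply, Matrix.vecMul, dotProduct, Fin.sum_univ_four]
        at h00 h01 h02 h03 h11 h12 h13 h22 h23 h33
      refine ⟨![M 0 2, 2 * M 2 0, M 1 2 - M 0 0 - M 2 2 - M 2 1, 2 * M 2 1,
        M 2 2 - M 0 0, -M 0 0 - M 2 2 - 2 * M 2 1], ?_⟩
      ext i j
      fin_cases i <;> fin_cases j <;> simp [cartanConnectionMatrix] <;> linarith
end
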